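/- Let G be a cubic graph with vertices v_0,…,v_{n−1} (n even) and edges e_0,…,e_{m−1}, m = 3n/2, and let J_G be the JRP-D instance associated with G. If G has a vertex cover of size K, then J_G has a feasible schedule of cost at most 10.5·n + K + 6. -/

import Mathlib

/-- An order `(t, R)` satisfies the demand of retailer `ρ` with period `[r, d]`. -/
def SatJG (S : Finset (ℝ × Finset ℕ)) (ρ : ℕ) (r d : ℝ) : Prop :=
  ∃ o ∈ S, ρ ∈ o.2 ∧ r ≤ o.1 ∧ o.1 ≤ d

/-- The time point `α_{i,a}` associated with vertex `i` and its `a`-th incident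
edge `j i a`: it is `2·(j i a)` if `i` is smaller than the other endpoint,
and `2·(j i a) + 1` otherwise. -/
def alphaPt {n m : ℕ} (E : Fin m → Fin n × Fin n) (j : Fin n → Fin 3 → Fin m)
    (i : Fin n) (a : Fin 3) : ℝ :=
  let e := j i a
  let i' : Fin n := if (E e).1 = i then (E e).2 else (E e).1
  if (i : ℕ) < (i' : ℕ) then 2 * (e : ℕ) else 2 * (e : ℕ) + 1

/-- The time point `β_i = 8m − i` associated with vertex `i`. -/
def betaPt (m : ℕ) (i : ℕ) : ℝ := 8 * (m : ℝ) - (i : ℝ)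

/-- Feasibility of a schedule for the instance `J_G`: every demand of the
support retailer 0, of the edge retailers `1,…,m`, and of the vertex retailers
`ρ_{i,a} = m+1+3i+a` is satisfied. -/
def FeasibleJG {n m : ℕ} (E : Fin m → Fin n × Fin n) (j : Fin n → Fin 3 → Fin m)
    (S : Finset (ℝ × Finset ℕ)) : Prop :=
  (SatJG S 0 (-(4 * (m : ℝ)) - 1) (-1) ∧
   SatJG S 0 (2 * (m : ℝ)) (6 * (m : ℝ)) ∧
   SatJG S 0 (8 * (m : ℝ) + 1) (12 * (m : ℝ) + 1)) ∧
  (∀ e : Fin m,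
    SatJG S ((e : ℕ) + 1) (2 * (e : ℕ) + 1 - 4 * (m : ℝ)) (2 * (e : ℕ) + 1) ∧
    SatJG S ((e : ℕ) + 1) (2 * (e : ℕ)) (2 * (e : ℕ) + 4 * (m : ℝ))) ∧
  (∀ i : Fin n, ∀ a : Fin 3,
    SatJG S (m + 1 + 3 * (i : ℕ) + (a : ℕ)) (alphaPt E j i a - 4 * (m : ℝ)) (alphaPt E j i a) ∧
    SatJG S (m + 1 + 3 * (i : ℕ) + (a : ℕ)) (alphaPt E j i a) (alphaPt E j i a + 4 * (m : ℝ)) ∧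
    SatJG S (m + 1 + 3 * (i : ℕ) + (a : ℕ)) (betaPt m i - 4 * (m : ℝ)) (betaPt m i) ∧
    SatJG S (m + 1 + 3 * (i : ℕ) + (a : ℕ)) (betaPt m i) (betaPt m i + 4 * (m : ℝ)))

/-- The cost of a schedule in `J_G` (all ordering costs equal 1). -/
noncomputable def costJG (S : Finset (ℝ × Finset ℕ)) : ℝ :=
  ∑ o ∈ S, (1 + (o.2.card : ℝ))

theorem SatJG.mono {S T : Finset (ℝ × Finset ℕ)} (h : S ⊆ T) {ρ : ℕ} {r d : ℝ}
    (hS : SatJG S ρ r d) : SatJG T ρ r d :=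
  hS.imp fun _ ho => ⟨h ho.1, ho.2⟩

theorem costJG_union_le (S T : Finset (ℝ × Finset ℕ)) :
    costJG (S ∪ T) ≤ costJG S + costJG T := by
  unfold costJG
  rw [← Finset.sum_union_inter]
  exact le_add_of_nonneg_right (Finset.sum_nonneg fun _ _ => by positivity)

theorem costJG_image_le {ι : Type*} (s : Finset ι) (t : ι → ℝ) (R : ι → Finset ℕ) :
    costJG (s.image fun x => (t x, R x)) ≤ ∑ x ∈ s, (1 + ((R x).card : ℝ)) :=
  Finset.sum_image_le_of_nonneg fun _ _ => by positivity

theorem alphaPt_bounds {n m : ℕ} (E : Fin m → Fin n × Fin n) (j : Fin n → Fin 3 → Fin m)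
    (i : Fin n) (a : Fin 3) :
    2 * ((j i a : ℕ) : ℝ) ≤ alphaPt E j i a ∧ alphaPt E j i a ≤ 2 * ((j i a : ℕ) : ℝ) + 1 := by
  dsimp only [alphaPt]
  split_ifs <;> constructor <;> linarith

/-- The retailer `ρ_{i,a}` of `J_G`. -/
def vertexRetailer {n : ℕ} (m : ℕ) (p : Fin n × Fin 3) : ℕ :=
  m + 1 + 3 * (p.1 : ℕ) + (p.2 : ℕ)

/-- The retailers ordering at the three support times: the support retailer and all vertex
retailers whose pair is not assigned to an edge by `f`. -/
def supportRetailers {n m : ℕ} (f : Fin m → Fin n × Fin 3) : Finset ℕ :=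
  insert 0 ((Finset.univ \ Finset.univ.image f).image (vertexRetailer m))

/-- The orders at the times `-1`, `4m` and `8m + 1`. -/
noncomputable def supportOrders {n m : ℕ} (f : Fin m → Fin n × Fin 3) :
    Finset (ℝ × Finset ℕ) :=
  ({-1, 4 * (m : ℝ), 8 * (m : ℝ) + 1} : Finset ℝ).image fun t => (t, supportRetailers f)

/-- For each edge, an order shared by its retailer and the vertex retailer assigned to it. -/
noncomputable def edgeOrders {n m : ℕ} (E : Fin m → Fin n × Fin n) (j : Fin n → Fin 3 → Fin m)
    (f : Fin m → Fin n × Fin 3) : Finset (ℝ × Finset ℕ) :=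
  Finset.univ.image fun e : Fin m =>
    (alphaPt E j (f e).1 (f e).2, ({(e : ℕ) + 1, vertexRetailer m (f e)} : Finset ℕ))

/-- For each vertex `i` of the cover, an order at `β_i` of its assigned retailers. -/
noncomputable def coverOrders {n m : ℕ} (U : Finset (Fin n)) (f : Fin m → Fin n × Fin 3) :
    Finset (ℝ × Finset ℕ) :=
  U.image fun i : Fin n =>
    (betaPt m i, (Finset.univ.filter fun e => (f e).1 = i).image (vertexRetailer m ∘ f))

theorem card_supportRetailers_le {n m : ℕ} {f : Fin m → Fin n × Fin 3}
    (hf : Function.Injective f) :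
    ((supportRetailers f).card : ℝ) ≤ 1 + (3 * n - m) := by
  have h1 : (supportRetailers f).card ≤ (Finset.univ \ Finset.univ.image f).card + 1 :=
    (Finset.card_insert_le _ _).trans (Nat.add_le_add_right Finset.card_image_le 1)
  have h2 := Finset.card_sdiff_add_card_eq_card (Finset.subset_univ (Finset.univ.image f))
  rw [Finset.card_image_of_injective _ hf] at h2
  simp only [Finset.card_univ, Fintype.card_prod, Fintype.card_fin] at h2
  have h1' : ((supportRetailers f).card : ℝ)
      ≤ ((Finset.univ \ Finset.univ.image f).card : ℝ) + 1 := mod_cast h1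
  have h2' : ((Finset.univ \ Finset.univ.image f).card : ℝ) + m = n * 3 := mod_cast h2
  linarith

theorem costJG_supportOrders_le {n m : ℕ} {f : Fin m → Fin n × Fin 3}
    (hf : Function.Injective f) :
    costJG (supportOrders f) ≤ 3 * (2 + (3 * n - m)) := by
  have hR := card_supportRetailers_le hf
  have h3 : ((({-1, 4 * (m : ℝ), 8 * (m : ℝ) + 1} : Finset ℝ).card : ℕ) : ℝ) ≤ 3 :=
    mod_cast Finset.card_le_three
  calc costJG (supportOrders f)
      ≤ _ := costJG_image_le _ (fun t => t) fun _ => supportRetailers f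
    _ = _ * (1 + ((supportRetailers f).card : ℝ)) := by rw [Finset.sum_const, nsmul_eq_mul]
    _ ≤ 3 * (1 + ((supportRetailers f).card : ℝ)) := by gcongr
    _ ≤ _ := by linarith

theorem costJG_edgeOrders_le {n m : ℕ} (E : Fin m → Fin n × Fin n)
    (j : Fin n → Fin 3 → Fin m) (f : Fin m → Fin n × Fin 3) :
    costJG (edgeOrders E j f) ≤ 3 * m := by
  refine (costJG_image_le _ _ _).trans ?_
  have h2 : ∀ e ∈ (Finset.univ : Finset (Fin m)),
      1 + ((({(e : ℕ) + 1, vertexRetailer m (f e)} : Finset ℕ).card : ℕ) : ℝ) ≤ 3 := by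
    intro e _
    have : ((({(e : ℕ) + 1, vertexRetailer m (f e)} : Finset ℕ).card : ℕ) : ℝ) ≤ 2 :=
      mod_cast Finset.card_le_two
    linarith
  refine (Finset.sum_le_sum h2).trans_eq ?_
  simp [mul_comm]

theorem costJG_coverOrders_le {n m : ℕ} (U : Finset (Fin n)) {f : Fin m → Fin n × Fin 3}
    (hfU : ∀ e, (f e).1 ∈ U) :
    costJG (coverOrders U f) ≤ U.card + m := by
  have hcard : (m : ℝ) = ∑ i ∈ U, ((Finset.univ.filter fun e => (f e).1 = i).card : ℝ) := by
    have h := Finset.card_eq_sum_card_fiberwise (s := Finset.univ) (t := U)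
      (f := fun e => (f e).1) fun e _ => hfU e
    rw [Finset.card_univ, Fintype.card_fin] at h
    exact mod_cast h
  refine (costJG_image_le _ _ _).trans ?_
  rw [Finset.sum_add_distrib, Finset.sum_const, nsmul_eq_mul, mul_one, hcard]
  gcongr
  exact Finset.card_image_le

theorem satJG_supportOrders {n m : ℕ} {f : Fin m → Fin n × Fin 3} {ρ : ℕ}
    (hρ : ρ ∈ supportRetailers f) {t r d : ℝ} (ht : t = -1 ∨ t = 4 * m ∨ t = 8 * m + 1)
    (hr : r ≤ t) (hd : t ≤ d) : SatJG (supportOrders f) ρ r d :=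
  ⟨(t, supportRetailers f), Finset.mem_image.2 ⟨t, by simpa using ht, rfl⟩, hρ, hr, hd⟩

theorem satJG_edgeOrders {n m : ℕ} {E : Fin m → Fin n × Fin n} {j : Fin n → Fin 3 → Fin m}
    {f : Fin m → Fin n × Fin 3} (e : Fin m) {ρ : ℕ}
    (hρ : ρ = e + 1 ∨ ρ = vertexRetailer m (f e)) {r d : ℝ}
    (hr : r ≤ alphaPt E j (f e).1 (f e).2) (hd : alphaPt E j (f e).1 (f e).2 ≤ d) :
    SatJG (edgeOrders E j f) ρ r d :=
  ⟨_, Finset.mem_image.2 ⟨e, Finset.mem_univ e, rfl⟩, by simpa using hρ, hr, hd⟩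

theorem satJG_coverOrders {n m : ℕ} {U : Finset (Fin n)} {f : Fin m → Fin n × Fin 3}
    (hfU : ∀ e, (f e).1 ∈ U) (e : Fin m) {r d : ℝ}
    (hr : r ≤ betaPt m (f e).1) (hd : betaPt m (f e).1 ≤ d) :
    SatJG (coverOrders U f) (vertexRetailer m (f e)) r d :=
  ⟨_, Finset.mem_image.2 ⟨(f e).1, hfU e, rfl⟩,
    Finset.mem_image.2 ⟨e, by simp, rfl⟩, hr, hd⟩

/-- An assignment of each edge to one of its incidences with the cover yields a feasible
schedule. -/
theorem feasibleJG_of_assignment {n m : ℕ} (hm : 2 * m = 3 * n) (E : Fin m → Fin n × Fin n)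
    (j : Fin n → Fin 3 → Fin m) {U : Finset (Fin n)} {f : Fin m → Fin n × Fin 3}
    (hfU : ∀ e, (f e).1 ∈ U) (hjf : ∀ e, j (f e).1 (f e).2 = e) :
    FeasibleJG E j (supportOrders f ∪ edgeOrders E j f ∪ coverOrders U f) := by
  have hm' : 2 * (m : ℝ) = 3 * n := mod_cast hm
  have hn0 : (0 : ℝ) ≤ n := n.cast_nonneg
  have hS : supportOrders f ⊆ supportOrders f ∪ edgeOrders E j f ∪ coverOrders U f :=
    Finset.subset_union_left.trans Finset.subset_union_left
  have hE : edgeOrders E j f ⊆ supportOrders f ∪ edgeOrders E j f ∪ coverOrders U f :=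
    Finset.subset_union_right.trans Finset.subset_union_left
  have hC : coverOrders U f ⊆ supportOrders f ∪ edgeOrders E j f ∪ coverOrders U f :=
    Finset.subset_union_right
  have h0 : 0 ∈ supportRetailers f := Finset.mem_insert_self _ _
  refine ⟨⟨?_, ?_, ?_⟩, fun e => ?_, fun i a => ?_⟩
  · exact (satJG_supportOrders h0 (Or.inl rfl) (by linarith) le_rfl).mono hS
  · exact (satJG_supportOrders h0 (Or.inr (Or.inl rfl)) (by linarith) (by linarith)).mono hS
  · exact (satJG_supportOrders h0 (Or.inr (Or.inr rfl)) le_rfl (by linarith)).mono hS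
  · have hb := alphaPt_bounds E j (f e).1 (f e).2
    rw [hjf] at hb
    have hm1 : (1 : ℝ) ≤ m := mod_cast e.pos
    exact ⟨(satJG_edgeOrders e (Or.inl rfl) (by linarith) hb.2).mono hE,
      (satJG_edgeOrders e (Or.inl rfl) hb.1 (by linarith)).mono hE⟩
  · have hi : ((i : ℕ) : ℝ) + 1 ≤ n := mod_cast i.isLt
    have hi0 : (0 : ℝ) ≤ ((i : ℕ) : ℝ) := Nat.cast_nonneg _
    change SatJG _ (vertexRetailer m (i, a)) _ _ ∧ SatJG _ (vertexRetailer m (i, a)) _ _ ∧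
      SatJG _ (vertexRetailer m (i, a)) _ _ ∧ SatJG _ (vertexRetailer m (i, a)) _ _
    by_cases h : (i, a) ∈ Finset.univ.image f
    · obtain ⟨e, -, he⟩ := Finset.mem_image.1 h
      obtain ⟨rfl, rfl⟩ : (f e).1 = i ∧ (f e).2 = a := Prod.ext_iff.1 he
      exact ⟨(satJG_edgeOrders e (Or.inr rfl) (by linarith) le_rfl).mono hE,
        (satJG_edgeOrders e (Or.inr rfl) le_rfl (by linarith)).mono hE,
        (satJG_coverOrders hfU e (by linarith) le_rfl).mono hC,
        (satJG_coverOrders hfU e le_rfl (by linarith)).mono hC⟩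
    · have hρ : vertexRetailer m (i, a) ∈ supportRetailers f :=
        Finset.mem_insert_of_mem (Finset.mem_image_of_mem _ (by simpa using h))
      obtain ⟨hl, hu⟩ := alphaPt_bounds E j i a
      have hj : ((j i a : ℕ) : ℝ) + 1 ≤ m := mod_cast (j i a).isLt
      have hj0 : (0 : ℝ) ≤ ((j i a : ℕ) : ℝ) := Nat.cast_nonneg _
      have hβ : betaPt m i = 8 * (m : ℝ) - (i : ℕ) := rfl
      exact ⟨(satJG_supportOrders hρ (Or.inl rfl) (by linarith) (by linarith)).mono hS,
        (satJG_supportOrders hρ (Or.inr (Or.inl rfl)) (by linarith) (by linarith)).mono hS,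
        (satJG_supportOrders hρ (Or.inr (Or.inl rfl)) (by linarith) (by linarith)).mono hS,
        (satJG_supportOrders hρ (Or.inr (Or.inr rfl)) (by linarith) (by linarith)).mono hS⟩

theorem vertex_cover_to_schedule
    (n m : ℕ) (hn : Even n) (hm : 2 * m = 3 * n)
    (E : Fin m → Fin n × Fin n) (hE : ∀ e, (E e).1 ≠ (E e).2)
    (j : Fin n → Fin 3 → Fin m)
    (hinc : ∀ i a, (E (j i a)).1 = i ∨ (E (j i a)).2 = i)
    (hjinj : ∀ i, Function.Injective (j i))
    (hcov : ∀ i e, ((E e).1 = i ∨ (E e).2 = i) → ∃ a, j i a = e)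
    (K : ℕ) (Uc : Finset (Fin n)) (hUc : ∀ e, (E e).1 ∈ Uc ∨ (E e).2 ∈ Uc)
    (hK : Uc.card = K) :
    ∃ S : Finset (ℝ × Finset ℕ), FeasibleJG E j S ∧
      costJG S ≤ 10.5 * (n : ℝ) + (K : ℝ) + 6 := by
  have hassign : ∀ e, ∃ p : Fin n × Fin 3, p.1 ∈ Uc ∧ j p.1 p.2 = e := fun e => by
    rcases hUc e with h | h
    · obtain ⟨a, ha⟩ := hcov _ e (Or.inl rfl)
      exact ⟨(_, a), h, ha⟩
    · obtain ⟨a, ha⟩ := hcov _ e (Or.inr rfl)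
      exact ⟨(_, a), h, ha⟩
  choose f hfU hjf using hassign
  have hf : Function.Injective f :=
    Function.LeftInverse.injective (g := fun p : Fin n × Fin 3 => j p.1 p.2) hjf
  refine ⟨_, feasibleJG_of_assignment hm E j hfU hjf, ?_⟩
  have hm' : 2 * (m : ℝ) = 3 * n := mod_cast hm
  have h1 := costJG_union_le (supportOrders f ∪ edgeOrders E j f) (coverOrders Uc f)
  have h2 := costJG_union_le (supportOrders f) (edgeOrders E j f)
  have h3 := costJG_supportOrders_le hf
  have h4 := costJG_edgeOrders_le E j f
  have h5 := costJG_coverOrders_le Uc hfU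
  rw [hK] at h5
  linarith
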